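/- Let n ≥ 2, set k = n if n is odd and k = n−1 if n is even, and let E_n denote the n×n all-ones matrix minus the identity. Then there exists a feasible decomposition λ of −E_n with Σ_m λ(m) = k; explicitly, one may take λ(m) = k / C(k, ⌊k/2⌋) for each encoding m = (−1)^b with b ∈ S = { b ∈ 𝔽₂^n : b_n = 0 and |b| ∈ {⌊n/2⌋, ⌈n/2⌉} } (entrywise, m_i = (−1)^{b_i}), and λ(m) = 0 otherwise. -/

import Mathlib

/-- The sign `m = (−1)^b` of a bit: encodings `m ∈ {−1,+1}^n` are represented by
boolean vectors `b : Fin n → Bool` via `m i = sgn (b i)`. -/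
def sgn (b : Bool) : ℝ := if b then -1 else 1

/-- `lam` is a feasible decomposition of `M ∈ Sym₀(ℝ^n)`:
`lam ≥ 0` and `M i j = Σ_{m ∈ {−1,+1}^n} lam m * m_i * m_j` for all `i ≠ j`. -/
def IsDecomp {n : ℕ} (M : Matrix (Fin n) (Fin n) ℝ)
    (lam : (Fin n → Bool) → ℝ) : Prop :=
  (∀ m, 0 ≤ lam m) ∧
  ∀ i j : Fin n, i ≠ j →
    M i j = ∑ m : Fin n → Bool, lam m * sgn (m i) * sgn (m j)

/-- The optimal gate time `T(M)`: infimum of `Σ_m lam m` over feasible decompositions. -/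
noncomputable def gateTime {n : ℕ} (M : Matrix (Fin n) (Fin n) ℝ) : ℝ :=
  sInf { t | ∃ lam, IsDecomp M lam ∧ ∑ m : Fin n → Bool, lam m = t }


/-- The number of `true` bits of a boolean vector. -/
def bitWeight {n : ℕ} (b : Fin n → Bool) : ℕ :=
  (Finset.univ.filter (fun a => b a = true)).card

lemma sgn_mul_self (b : Bool) : sgn b * sgn b = 1 := by
  cases b <;> norm_num [sgn]

lemma sgn_not (b : Bool) : sgn (!b) = -sgn b := by
  cases b <;> norm_num [sgn]

lemma sum_sgn {n : ℕ} (b : Fin n → Bool) :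
    ∑ a, sgn (b a) = (n : ℝ) - 2 * (bitWeight b : ℝ) := by
  have h : ∀ a, sgn (b a) = 1 - 2 * (if b a = true then (1 : ℝ) else 0) := by
    intro a
    cases b a <;> norm_num [sgn]
  simp only [h, Finset.sum_sub_distrib, ← Finset.mul_sum, Finset.sum_boole, bitWeight]
  simp

lemma bitWeight_comp_perm {n : ℕ} (b : Fin n → Bool) (σ : Equiv.Perm (Fin n)) :
    bitWeight (b ∘ σ) = bitWeight b :=
  Finset.card_equiv σ (by simp)

lemma bitWeight_not {n : ℕ} (b : Fin n → Bool) :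
    bitWeight (fun a => !b a) = n - bitWeight b := by
  have h := Finset.card_filter_add_card_filter_not (s := (Finset.univ : Finset (Fin n)))
    (fun a => b a = true)
  simp only [Finset.card_univ, Fintype.card_fin] at h
  simp only [bitWeight, Bool.not_eq_true']
  simp only [Bool.not_eq_true] at h
  omega

lemma card_bitWeight_eq (n r : ℕ) :
    (Finset.univ.filter (fun b : Fin n → Bool => bitWeight b = r)).card = n.choose r := by
  have h := Finset.card_powersetCard r (Finset.univ : Finset (Fin n))
  rw [Finset.card_univ, Fintype.card_fin] at h
  rw [← h]
  refine Finset.card_nbij' (fun b => Finset.univ.filter (fun a => b a = true))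
    (fun s a => decide (a ∈ s)) ?_ ?_ ?_ ?_
  · intro b hb
    exact Finset.mem_powersetCard.2 ⟨Finset.subset_univ _, (Finset.mem_filter.1 hb).2⟩
  · intro s hs
    refine Finset.mem_filter.2 ⟨Finset.mem_univ _, ?_⟩
    simpa [bitWeight] using (Finset.mem_powersetCard.1 hs).2
  · intro b _
    simp
  · intro s _
    simp

/-- Complementation of the bits pairs the vectors with `b t = false` with those with
`b t = true`. -/
lemma two_mul_sum_ite_false {n : ℕ} (t : Fin n) (f : (Fin n → Bool) → ℝ)
    (hf : ∀ b, f (fun a => !b a) = f b) :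
    2 * ∑ b, (if b t = false then f b else 0) = ∑ b, f b := by
  have h : ∑ b, (if b t = false then f b else 0) = ∑ b, (if b t = true then f b else 0) := by
    refine Fintype.sum_equiv (Equiv.piCongrRight fun _ => Equiv.boolNot) _ _ fun b => ?_
    simp only [Equiv.piCongrRight_apply, Pi.map_apply, Equiv.boolNot_apply]
    have := hf b
    cases hb : b t <;> simp
    exact this.symm
  rw [two_mul]
  nth_rewrite 2 [h]
  rw [← Finset.sum_add_distrib]
  refine Finset.sum_congr rfl fun b _ => ?_
  cases b t <;> simp

/-- For a permutation-invariant weight supported where `(∑ a, m a) ^ 2 = s`, all pair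
correlations agree and are determined by the total weight. -/
lemma pair_correlation {n : ℕ} (g : (Fin n → Bool) → ℝ)
    (hg : ∀ b (σ : Equiv.Perm (Fin n)), g (b ∘ σ) = g b) (s : ℝ)
    (hs : ∀ b, g b * (∑ a, sgn (b a)) ^ 2 = g b * s) {i j : Fin n} (hij : i ≠ j) :
    (n : ℝ) * (n - 1) * ∑ b, g b * (sgn (b i) * sgn (b j)) = (s - n) * ∑ b, g b := by
  set Q : Fin n → Fin n → ℝ := fun i j => ∑ b, g b * (sgn (b i) * sgn (b j)) with hQ
  have comm : ∀ x y, Q x y = Q y x := fun x y =>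
    Finset.sum_congr rfl fun b _ => by ring
  have swap : ∀ x y z, x ≠ y → x ≠ z → Q x y = Q x z := by
    intro x y z hy hz
    refine Fintype.sum_equiv ((Equiv.swap y z).arrowCongr (Equiv.refl Bool)) _ _ fun b => ?_
    change _ = g (b ∘ Equiv.swap y z) *
      (sgn (b (Equiv.swap y z x)) * sgn (b (Equiv.swap y z z)))
    rw [hg, Equiv.swap_apply_right, Equiv.swap_apply_of_ne_of_ne hy hz]
  have const : ∀ x y, x ≠ y → Q x y = Q i j := by
    intro x y hxy
    by_cases hx : x = i
    · subst hx
      exact swap _ _ _ hxy hij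
    · rw [swap x y i hxy hx, comm, swap i x j (Ne.symm hx) hij]
  have diag : ∀ x, Q x x = ∑ b, g b := fun x => by simp [hQ, sgn_mul_self]
  have total : ∑ x, ∑ y, Q x y = s * ∑ b, g b := by
    have h1 : ∀ x, ∑ y, Q x y = ∑ b, ∑ y, g b * (sgn (b x) * sgn (b y)) :=
      fun x => Finset.sum_comm
    simp only [h1]
    rw [Finset.sum_comm, Finset.mul_sum]
    refine Finset.sum_congr rfl fun b _ => ?_
    rw [mul_comm s, ← hs b, sq, Finset.sum_mul_sum, Finset.mul_sum]
    simp only [Finset.mul_sum]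
  have row : ∀ x, ∑ y, Q x y = ∑ b, g b + (n - 1) * Q i j := by
    intro x
    rw [← Finset.add_sum_erase _ _ (Finset.mem_univ x), diag,
      Finset.sum_congr rfl fun y hy => const x y (Finset.ne_of_mem_erase hy).symm,
      Finset.sum_const, Finset.card_erase_of_mem (Finset.mem_univ x), Finset.card_univ,
      Fintype.card_fin, nsmul_eq_mul]
    have : 1 ≤ n := by have := x.2; omega
    rw [Nat.cast_sub this, Nat.cast_one]
  simp only [row, Finset.sum_const, Finset.card_univ, Fintype.card_fin, nsmul_eq_mul] at total
  change (n : ℝ) * (n - 1) * Q i j = _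
  linarith

/-- The number of vectors of near-balanced weight. -/
lemma card_balanced {n : ℕ} (hn : 2 ≤ n) (k : ℕ) (hk : k = if Odd n then n else n - 1) :
    (Finset.univ.filter (fun b : Fin n → Bool =>
      bitWeight b = n / 2 ∨ bitWeight b = (n + 1) / 2)).card = 2 * k.choose (k / 2) := by
  rcases Nat.even_or_odd' n with ⟨p, rfl | rfl⟩
  · have hk' : k = 2 * p - 1 := by rwa [if_neg (by simp)] at hk
    obtain ⟨q, rfl⟩ : ∃ q, p = q + 1 := ⟨p - 1, by omega⟩
    have e1 : 2 * (q + 1) / 2 = q + 1 := by omega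
    have e2 : (2 * (q + 1) + 1) / 2 = q + 1 := by omega
    have e3 : k = 2 * q + 1 := by omega
    have e4 : (2 * q + 1) / 2 = q := by omega
    simp only [e1, e2, or_self, card_bitWeight_eq, e3, e4]
    rw [show 2 * (q + 1) = 2 * q + 1 + 1 by ring, Nat.choose_succ_succ,
      Nat.choose_symm_half]
    ring
  · have hk' : k = 2 * p + 1 := by simpa using hk
    have e1 : (2 * p + 1) / 2 = p := by omega
    have e2 : (2 * p + 1 + 1) / 2 = p + 1 := by omega
    simp only [hk', e1, e2]
    rw [Finset.filter_or, Finset.card_union_of_disjoint, card_bitWeight_eq, card_bitWeight_eq,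
      Nat.choose_symm_half]
    · ring
    · refine Finset.disjoint_filter.2 fun b _ h => ?_
      omega

/-- for `n ≥ 2` and `k = n` (odd `n`) / `k = n−1` (even `n`), the explicit
assignment `λ(m) = k / C(k, ⌊k/2⌋)` for encodings `m = (−1)^b` with
`b ∈ S = { b : b_n = 0, |b| ∈ {⌊n/2⌋, ⌈n/2⌉} }` and `λ(m) = 0` otherwise is a feasible
decomposition of `−E_n` with total `Σ_m λ(m) = k`. (Encodings `m = (−1)^b` are represented
by their bit vectors `b`, `m_i = sgn (b_i)`.) -/
theorem stmt_15 {n : ℕ} (hn : 2 ≤ n) (k : ℕ)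
    (hk : k = if Odd n then n else n - 1)
    (lam : (Fin n → Bool) → ℝ)
    (hlam : ∀ b : Fin n → Bool,
      lam b = if b ⟨n - 1, by omega⟩ = false ∧
          ((Finset.univ.filter (fun a => b a = true)).card = n / 2 ∨
           (Finset.univ.filter (fun a => b a = true)).card = (n + 1) / 2)
        then (k : ℝ) / (k.choose (k / 2) : ℝ) else 0) :
    IsDecomp (Matrix.of fun i j : Fin n => if i = j then (0 : ℝ) else -1) lam ∧
    ∑ b : Fin n → Bool, lam b = (k : ℝ) := by
  set g : (Fin n → Bool) → ℝ := fun b =>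
    if bitWeight b = n / 2 ∨ bitWeight b = (n + 1) / 2 then 1 else 0 with hg
  set c : ℝ := (k : ℝ) / (k.choose (k / 2) : ℝ) with hc
  set t : Fin n := ⟨n - 1, by omega⟩ with ht
  have hlam' : ∀ b, lam b = c * (if b t = false then g b else 0) := by
    intro b
    rw [hlam b]
    simp only [hg, bitWeight]
    split_ifs <;> simp_all
  have hC : (0 : ℝ) < k.choose (k / 2) := by
    exact_mod_cast Nat.choose_pos (Nat.div_le_self k 2)
  have hnot : ∀ b, g (fun a => !b a) = g b := by
    intro b
    have hle : bitWeight b ≤ n := by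
      simpa [bitWeight] using Finset.card_filter_le (Finset.univ : Finset (Fin n))
        (fun a => b a = true)
    simp only [hg, bitWeight_not]
    congr 1
    apply propext
    omega
  have hperm : ∀ b (σ : Equiv.Perm (Fin n)), g (b ∘ σ) = g b := by
    intro b σ
    simp only [hg, bitWeight_comp_perm]
  have hG : ∑ b, g b = 2 * (k.choose (k / 2) : ℝ) := by
    simp only [hg, Finset.sum_boole, card_balanced hn k hk]
    push_cast
    rfl
  refine ⟨⟨fun b => ?_, fun i j hij => ?_⟩, ?_⟩
  · rw [hlam b]
    split_ifs <;> positivity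
  · have hhalf := two_mul_sum_ite_false t (fun b => g b * (sgn (b i) * sgn (b j)))
      (fun b => by simp only [hnot, sgn_not]; ring)
    have hsum : ∑ b, lam b * sgn (b i) * sgn (b j) =
        c * ∑ b, (if b t = false then g b * (sgn (b i) * sgn (b j)) else 0) := by
      rw [Finset.mul_sum]
      refine Finset.sum_congr rfl fun b _ => ?_
      rw [hlam' b]
      split_ifs <;> ring
    have hn' : (2 : ℝ) ≤ n := by exact_mod_cast hn
    have key : (k : ℝ) * ∑ b, g b * (sgn (b i) * sgn (b j)) = -∑ b, g b := by
      rcases Nat.even_or_odd' n with ⟨p, hp | hp⟩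
      · have hkr : (k : ℝ) = n - 1 := by
          have : k + 1 = n := by
            rw [hk, if_neg (by rw [hp]; simp)]
            omega
          rw [← this]
          simp
        have h := pair_correlation g hperm 0 (fun b => by
          simp only [hg, sum_sgn]
          split_ifs with hb
          · have : n = 2 * bitWeight b := by omega
            have : (n : ℝ) = 2 * bitWeight b := by exact_mod_cast this
            rw [this]
            ring
          · simp) hij
        rw [hkr]
        have hne : (n : ℝ) ≠ 0 := by linarith
        apply mul_left_cancel₀ hne
        linarith
      · have hkr : (k : ℝ) = n := by
          rw [hk, if_pos (by rw [hp]; simp)]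
        have h := pair_correlation g hperm 1 (fun b => by
          simp only [hg, sum_sgn]
          split_ifs with hb
          · have : n = 2 * bitWeight b + 1 ∨ n + 1 = 2 * bitWeight b := by omega
            have : (n : ℝ) = 2 * bitWeight b + 1 ∨ (n : ℝ) + 1 = 2 * bitWeight b := by
              exact_mod_cast this
            rcases this with h | h
            · rw [h]
              ring
            · rw [← h]
              ring
          · simp) hij
        rw [hkr]
        have hne : (n : ℝ) - 1 ≠ 0 := by linarith
        apply mul_left_cancel₀ hne
        linarith
    rw [hsum, Matrix.of_apply, if_neg hij, hc]
    rw [hG, ← hhalf] at key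
    rw [div_mul_eq_mul_div, eq_div_iff hC.ne']
    linarith
  · have hhalf := two_mul_sum_ite_false t g hnot
    simp only [hlam', ← Finset.mul_sum]
    have : ∑ b, (if b t = false then g b else 0) = (k.choose (k / 2) : ℝ) := by linarith
    rw [this, hc]
    field_simp
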